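/- Let V be a nonempty finite set and let (·,·) be a negative definite symmetric ℤ-valued bilinear form on L := ℤ^V with standard basis {E_v}_{v∈V}, satisfying (E_u,E_v) ≥ 0 for u ≠ v; let the dual graph G (edge between u ≠ v iff (E_u,E_v) > 0) be connected; let Z_K ∈ ℚ^V be the unique vector with (Z_K,E_v) = (E_v,E_v)+2 for all v, and χ(x) := −(x, x−Z_K)/2. Fix l' with (l',E_v) a nonnegative integer for every v, fix a cycle Z ∈ L with all coordinates ≥ 1, and assume there exists 0 < l ≤ Z with χ(−l'+l) ≤ χ(−l'). Let Z' be a ≤-minimal element of the set of cycles 0 < Z' ≤ Z realizing the maximum t(Z,l') = max_{0<Z''≤Z} Σ_i T(Z''_i,l'). Then for every connected component Z'_i of Z' one has χ(−l'+Z'_i) = min_{0≤l≤Z'_i} χ(−l'+l); that is, the minimum is realized by l = Z'_i. -/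

import Mathlib

open Classical

noncomputable section

/-- The rational pairing on `ℚ^V` determined by the integral matrix `M`. -/
def pairQ {V : Type} [Fintype V] (M : Matrix V V ℤ) (x y : V → ℚ) : ℚ :=
  ∑ u, ∑ v, x u * (M u v : ℚ) * y v

/-- The Riemann–Roch expression `χ(x) = −(x, x − Z_K)/2`. -/
def chiQ {V : Type} [Fintype V] (M : Matrix V V ℤ) (ZK : V → ℚ) (x : V → ℚ) : ℚ :=
  - pairQ M x (x - ZK) / 2

/-- Inclusion of integral cycles into `ℚ^V`. -/
def toQ {V : Type} (l : V → ℤ) : V → ℚ := fun v => (l v : ℚ)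

/-- The dual graph: `u ~ v` iff `u ≠ v` and `M u v > 0` (for symmetric `M`). -/
def dualGraph {V : Type} (M : Matrix V V ℤ) : SimpleGraph V :=
  SimpleGraph.fromRel (fun u v => 0 < M u v)

/-- The support `|Z|` of a cycle. -/
def supp {V : Type} (Z : V → ℤ) : Set V := {v | Z v ≠ 0}

/-- The dual graph induced on the support of a cycle. -/
def inducedOnSupp {V : Type} (M : Matrix V V ℤ) (Z : V → ℤ) :
    SimpleGraph (supp Z) :=
  (dualGraph M).induce (supp Z)

/-- The part `Z_c` of a cycle `Z` corresponding to a connected component `c`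
of the dual graph induced on the support of `Z`:  it agrees with `Z` on the
component and vanishes elsewhere. -/
def compCycle {V : Type} (M : Matrix V V ℤ) (Z : V → ℤ)
    (c : (inducedOnSupp M Z).ConnectedComponent) : V → ℤ := fun v =>
  if h : Z v ≠ 0 then
    (if (inducedOnSupp M Z).connectedComponentMk ⟨v, h⟩ = c then Z v else 0)
  else 0

/-- The sum `Σ_i F(Z_i)` of a quantity `F` over the connected components
`Z = Σ_i Z_i` of a cycle. -/
def sumComp {V : Type} [Fintype V] (M : Matrix V V ℤ)
    (F : (V → ℤ) → ℚ) (Z : V → ℤ) : ℚ :=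
  ∑ᶠ c : (inducedOnSupp M Z).ConnectedComponent, F (compCycle M Z c)

end

/-- Two cycles are separated if their supports are disjoint and no edge of the dual graph joins
them. -/
def Separated {V : Type} (M : Matrix V V ℤ) (A B : V → ℤ) : Prop :=
  ∀ u v, A u ≠ 0 → B v ≠ 0 → u ≠ v ∧ ¬ (dualGraph M).Adj u v

/-- `v` is reached from `u` by a path of the dual graph that stays, after `u`, in the support of
`W`. -/
def ReachIn {V : Type} (M : Matrix V V ℤ) (W : V → ℤ) : V → V → Prop :=
  Relation.ReflTransGen (fun a b => (dualGraph M).Adj a b ∧ W b ≠ 0)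

section Components

variable {V : Type} {M : Matrix V V ℤ} {A B W : V → ℤ}

theorem Separated.symm (h : Separated M A B) : Separated M B A := fun u v hu hv =>
  ⟨(h v u hv hu).1.symm, fun e => (h v u hv hu).2 e.symm⟩

theorem Separated.eq_zero_right (h : Separated M A B) {u : V} (hu : A u ≠ 0) : B u = 0 := by
  by_contra hB
  exact (h u u hu hB).1 rfl

theorem Separated.mono_right {B' : V → ℤ} (h : Separated M A B)
    (hB : ∀ v, B' v ≠ 0 → B v ≠ 0) : Separated M A B' :=
  fun u v hu hv => h u v hu (hB v hv)

theorem ReachIn.ne_zero {u v : V} (h : ReachIn M W u v) (hu : W u ≠ 0) : W v ≠ 0 := by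
  induction h with
  | refl => exact hu
  | tail _ h _ => exact h.2

theorem Separated.reachIn_add_iff (h : Separated M A B) {u v : V} (hu : A u ≠ 0) :
    ReachIn M (A + B) u v ↔ ReachIn M A u v := by
  constructor
  · intro hr
    induction hr with
    | refl => exact .refl
    | @tail a b _ hab ih =>
      refine ih.tail ⟨hab.1, fun hb => ?_⟩
      have hB : B b ≠ 0 := by simpa [hb] using hab.2
      exact (h a b (ih.ne_zero hu) hB).2 hab.1
  · intro hr
    refine Relation.ReflTransGen.mono (fun a b hab => ⟨hab.1, ?_⟩) _ _ hr
    simpa [h.eq_zero_right hab.2] using hab.2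

theorem connectedComponentMk_eq_iff {u v : V} (hu : W u ≠ 0) (hv : W v ≠ 0) :
    (inducedOnSupp M W).connectedComponentMk ⟨u, hu⟩ =
      (inducedOnSupp M W).connectedComponentMk ⟨v, hv⟩ ↔ ReachIn M W u v := by
  rw [SimpleGraph.ConnectedComponent.eq, SimpleGraph.reachable_iff_reflTransGen]
  constructor
  · intro h
    exact Relation.ReflTransGen.lift (p := fun a b => (dualGraph M).Adj a b ∧ W b ≠ 0)
      Subtype.val (fun a b hab => ⟨hab, b.2⟩) _ _ h
  · intro h
    induction h with
    | refl => exact .refl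
    | @tail a b hr hab ih => exact (ih (ReachIn.ne_zero hr hu)).tail hab.1

theorem compCycle_mk {v : V} (hv : W v ≠ 0) :
    compCycle M W ((inducedOnSupp M W).connectedComponentMk ⟨v, hv⟩) =
      fun u => if ReachIn M W v u then W u else 0 := by
  funext u
  by_cases hu : W u = 0
  · simp [compCycle, hu]
  · have := connectedComponentMk_eq_iff (M := M) hv hu
    rw [eq_comm] at this
    simp [compCycle, hu, this]

theorem range_compCycle : Set.range (compCycle M W) =
    {C | ∃ v, W v ≠ 0 ∧ C = fun u => if ReachIn M W v u then W u else 0} := by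
  ext C
  constructor
  · rintro ⟨c, rfl⟩
    induction c using SimpleGraph.ConnectedComponent.ind with
    | h v => exact ⟨v.1, v.2, compCycle_mk v.2⟩
  · rintro ⟨v, hv, rfl⟩
    exact ⟨_, compCycle_mk hv⟩

theorem compCycle_injective : Function.Injective (compCycle M W) := by
  intro c d h
  induction c using SimpleGraph.ConnectedComponent.ind with
  | h v =>
    have hv : W v.1 ≠ 0 := v.2
    have := congrFun h v.1
    by_contra hne
    simp [compCycle, hv, hne] at this

theorem finite_range_compCycle [Finite V] : (Set.range (compCycle M W)).Finite := by
  have : Finite (inducedOnSupp M W).ConnectedComponent :=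
    Finite.of_surjective (inducedOnSupp M W).connectedComponentMk
      (fun c => c.exists_rep)
  exact Set.finite_range _

theorem sumComp_eq_finsum_mem [Fintype V] (F : (V → ℤ) → ℚ) :
    sumComp M F W = ∑ᶠ C ∈ Set.range (compCycle M W), F C := by
  rw [finsum_mem_range compCycle_injective]
  rfl

theorem Separated.comp_add (h : Separated M A B) {v : V} (hv : A v ≠ 0) :
    (fun u => if ReachIn M (A + B) v u then (A + B) u else 0) =
      fun u => if ReachIn M A v u then A u else 0 := by
  funext u
  simp only [h.reachIn_add_iff hv]
  split_ifs with hr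
  · simp [h.eq_zero_right (hr.ne_zero hv)]
  · rfl

theorem Separated.range_compCycle_add (h : Separated M A B) :
    Set.range (compCycle M (A + B)) =
      Set.range (compCycle M A) ∪ Set.range (compCycle M B) := by
  simp only [range_compCycle]
  ext C
  constructor
  · rintro ⟨v, hv, rfl⟩
    by_cases hA : A v = 0
    · have hB : B v ≠ 0 := by simpa [hA] using hv
      right
      refine ⟨v, hB, ?_⟩
      rw [add_comm A B]
      exact h.symm.comp_add hB
    · exact Or.inl ⟨v, hA, h.comp_add hA⟩
  · rintro (⟨v, hv, rfl⟩ | ⟨v, hv, rfl⟩)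
    · exact ⟨v, by simpa [h.eq_zero_right hv] using hv, (h.comp_add hv).symm⟩
    · refine ⟨v, by simpa [h.symm.eq_zero_right hv] using hv, ?_⟩
      rw [add_comm A B]
      exact (h.symm.comp_add hv).symm

theorem Separated.disjoint_range_compCycle (h : Separated M A B) :
    Disjoint (Set.range (compCycle M A)) (Set.range (compCycle M B)) := by
  rw [Set.disjoint_left]
  simp only [range_compCycle]
  rintro _ ⟨v, hv, rfl⟩ ⟨w, hw, he⟩
  have := congrFun he v
  have hr : ReachIn M A v v := .refl
  simp [hr, h.eq_zero_right hv, hv] at this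

theorem Separated.sumComp_add [Fintype V] (h : Separated M A B) (F : (V → ℤ) → ℚ) :
    sumComp M F (A + B) = sumComp M F A + sumComp M F B := by
  simp only [sumComp_eq_finsum_mem, h.range_compCycle_add]
  exact finsum_mem_union h.disjoint_range_compCycle finite_range_compCycle
    finite_range_compCycle

theorem compCycle_ne_zero {c : (inducedOnSupp M W).ConnectedComponent} {v : V}
    (h : compCycle M W c v ≠ 0) :
    ∃ hv : W v ≠ 0, (inducedOnSupp M W).connectedComponentMk ⟨v, hv⟩ = c := by
  unfold compCycle at h
  split_ifs at h with h1 h2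
  · exact ⟨h1, h2⟩
  · exact absurd rfl h
  · exact absurd rfl h

theorem compCycle_apply_mk {v : V} (hv : W v ≠ 0) :
    compCycle M W ((inducedOnSupp M W).connectedComponentMk ⟨v, hv⟩) v = W v := by
  simp [compCycle, hv]

theorem compCycle_eq_or (c : (inducedOnSupp M W).ConnectedComponent) (v : V) :
    compCycle M W c v = W v ∨ compCycle M W c v = 0 := by
  unfold compCycle
  split_ifs <;> simp

theorem separated_compCycle (c : (inducedOnSupp M W).ConnectedComponent) :
    Separated M (compCycle M W c) (W - compCycle M W c) := by
  intro u v hu hv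
  obtain ⟨hWu, rfl⟩ := compCycle_ne_zero hu
  have hWv : W v ≠ 0 := by
    intro h0
    rcases compCycle_eq_or ((inducedOnSupp M W).connectedComponentMk ⟨u, hWu⟩) v with h | h <;>
      simp [h, h0] at hv
  have hne : (inducedOnSupp M W).connectedComponentMk ⟨v, hWv⟩ ≠
      (inducedOnSupp M W).connectedComponentMk ⟨u, hWu⟩ := by
    intro he
    rw [← he] at hv
    simp [compCycle_apply_mk hWv] at hv
  constructor
  · rintro rfl
    exact hne rfl
  · intro hadj
    exact hne ((connectedComponentMk_eq_iff hWu hWv).2 (.single ⟨hadj, hWv⟩)).symm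

theorem sumComp_eq_of_reachIn [Fintype V] (F : (V → ℤ) → ℚ) (hW : W ≠ 0)
    (h : ∀ u v, W u ≠ 0 → W v ≠ 0 → ReachIn M W u v) : sumComp M F W = F W := by
  have hr : Set.range (compCycle M W) = {W} := by
    have hcomp : ∀ v, W v ≠ 0 → (fun u => if ReachIn M W v u then W u else 0) = W := by
      intro v hv
      funext u
      split_ifs with hvu
      · rfl
      · by_contra hu
        exact hvu (h v u hv (Ne.symm hu))
    obtain ⟨v, hv⟩ := Function.ne_iff.1 hW
    rw [range_compCycle]
    ext C
    constructor
    · rintro ⟨w, hw, rfl⟩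
      exact hcomp w hw
    · rintro rfl
      exact ⟨v, hv, (hcomp v hv).symm⟩
  rw [sumComp_eq_finsum_mem, hr, finsum_mem_singleton]

theorem compCycle_ne (c : (inducedOnSupp M W).ConnectedComponent) : compCycle M W c ≠ 0 := by
  induction c using SimpleGraph.ConnectedComponent.ind with
  | h v =>
    intro h0
    exact v.2 (by simpa [compCycle_apply_mk v.2] using congrFun h0 v.1)

theorem sumComp_compCycle [Fintype V] (F : (V → ℤ) → ℚ)
    (c : (inducedOnSupp M W).ConnectedComponent) :
    sumComp M F (compCycle M W c) = F (compCycle M W c) := by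
  refine sumComp_eq_of_reachIn F (compCycle_ne c) fun u v hu hv => ?_
  rw [← (separated_compCycle c).reachIn_add_iff hu, add_sub_cancel]
  obtain ⟨hu', hcu⟩ := compCycle_ne_zero hu
  obtain ⟨hv', hcv⟩ := compCycle_ne_zero hv
  exact (connectedComponentMk_eq_iff hu' hv').1 (hcu.trans hcv.symm)

theorem sumComp_eq_add_sub [Fintype V] (F : (V → ℤ) → ℚ)
    (c : (inducedOnSupp M W).ConnectedComponent) :
    sumComp M F W = F (compCycle M W c) + sumComp M F (W - compCycle M W c) := by
  rw [← sumComp_compCycle F c, ← (separated_compCycle c).sumComp_add, add_sub_cancel]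

theorem sumComp_zero [Fintype V] (F : (V → ℤ) → ℚ) : sumComp M F (0 : V → ℤ) = 0 := by
  rw [sumComp_eq_finsum_mem, range_compCycle]
  simp

theorem compCycle_nonneg (hW : 0 ≤ W) (c : (inducedOnSupp M W).ConnectedComponent) :
    0 ≤ compCycle M W c := by
  intro v
  rcases compCycle_eq_or c v with h | h <;> simp only [h]
  · exact hW v
  · exact le_rfl

theorem compCycle_le (hW : 0 ≤ W) (c : (inducedOnSupp M W).ConnectedComponent) :
    compCycle M W c ≤ W := by
  intro v
  rcases compCycle_eq_or c v with h | h <;> rw [h]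
  exact hW v

/-- Induction on cycles, peeling off one connected component at a time. -/
theorem component_induction [Finite V] {P : (V → ℤ) → Prop} (zero : P 0)
    (step : ∀ (W : V → ℤ), 0 ≤ W → ∀ c : (inducedOnSupp M W).ConnectedComponent,
      P (W - compCycle M W c) → P W)
    (W : V → ℤ) (hW : 0 ≤ W) : P W := by
  induction hn : (supp W).ncard using Nat.strong_induction_on generalizing W with
  | h n ih =>
    by_cases h0 : W = 0
    · exact h0 ▸ zero
    · obtain ⟨v, hv : W v ≠ 0⟩ := Function.ne_iff.1 h0
      refine step W hW ((inducedOnSupp M W).connectedComponentMk ⟨v, hv⟩) ?_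
      refine ih _ ?_ _ (sub_nonneg.2 (compCycle_le hW _)) rfl
      rw [← hn]
      refine Set.ncard_lt_ncard ⟨fun u hu (hu0 : W u = 0) => ?_, fun hsub => ?_⟩ (Set.toFinite _)
      · refine hu (sub_eq_zero.2 ?_)
        rcases compCycle_eq_or ((inducedOnSupp M W).connectedComponentMk ⟨v, hv⟩) u with h | h
        · exact h.symm
        · exact hu0.trans h.symm
      · exact hsub hv (sub_eq_zero.2 (compCycle_apply_mk hv).symm)

theorem ReachIn.of_connected (hconn : (dualGraph M).Connected) (hW : ∀ v, W v ≠ 0) (u v : V) :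
    ReachIn M W u v := by
  have := (SimpleGraph.reachable_iff_reflTransGen u v).1 (hconn.preconnected u v)
  exact Relation.ReflTransGen.mono (fun a b hab => ⟨hab, hW b⟩) _ _ this

end Components

section RiemannRoch

variable {V : Type} [Fintype V] {M : Matrix V V ℤ}

theorem pairQ_add_left (x y z : V → ℚ) : pairQ M (x + y) z = pairQ M x z + pairQ M y z := by
  simp [pairQ, add_mul, Finset.sum_add_distrib]

theorem pairQ_add_right (x y z : V → ℚ) : pairQ M x (y + z) = pairQ M x y + pairQ M x z := by
  simp [pairQ, mul_add, Finset.sum_add_distrib]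

theorem pairQ_comm (hsym : ∀ u v, M u v = M v u) (x y : V → ℚ) : pairQ M x y = pairQ M y x := by
  unfold pairQ
  rw [Finset.sum_comm]
  refine Finset.sum_congr rfl fun u _ => Finset.sum_congr rfl fun v _ => ?_
  rw [hsym v u]
  ring

theorem Separated.pairQ_eq_zero (hoff : ∀ u v : V, u ≠ v → 0 ≤ M u v) {A B : V → ℤ}
    (h : Separated M A B) : pairQ M (toQ A) (toQ B) = 0 := by
  refine Finset.sum_eq_zero fun u _ => Finset.sum_eq_zero fun v _ => ?_
  by_cases hu : A u = 0
  · simp [toQ, hu]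
  by_cases hv : B v = 0
  · simp [toQ, hv]
  obtain ⟨hne, hadj⟩ := h u v hu hv
  have hM : M u v = 0 := by
    refine le_antisymm (not_lt.1 fun hpos => hadj ?_) (hoff u v hne)
    exact (SimpleGraph.fromRel_adj _ _ _).2 ⟨hne, Or.inl hpos⟩
  simp [hM]

theorem Separated.chiQ_add (hsym : ∀ u v, M u v = M v u)
    (hoff : ∀ u v : V, u ≠ v → 0 ≤ M u v) (ZK x : V → ℚ) {A B : V → ℤ}
    (h : Separated M A B) :
    chiQ M ZK (x + toQ (A + B)) + chiQ M ZK x =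
      chiQ M ZK (x + toQ A) + chiQ M ZK (x + toQ B) := by
  have hAB : toQ (A + B) = toQ A + toQ B := by
    funext v
    simp [toQ]
  have h1 := h.pairQ_eq_zero hoff
  have h2 := pairQ_comm hsym (toQ A) (toQ B)
  simp only [chiQ, hAB, sub_eq_add_neg, pairQ_add_left, pairQ_add_right]
  linarith

end RiemannRoch

theorem toQ_zero {V : Type} : toQ (0 : V → ℤ) = 0 := by
  funext v
  simp [toQ]

/-- The sum of `F` over the components of a cycle `l ≥ 0` dominates `-f l` if `f` is additive on
separated cycles and `F ≥ -f`; it dominates `1 - f l` if moreover `l ≠ 0`, `f l ≤ 0` and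
`F ≥ 1 - f` wherever `f ≤ 0`. -/
theorem neg_le_sumComp {V : Type} [Fintype V] {M : Matrix V V ℤ} {f F : (V → ℤ) → ℚ}
    (hf0 : f 0 = 0) (hadd : ∀ A B, Separated M A B → f (A + B) = f A + f B)
    (hF : ∀ l, 0 < l → -f l ≤ F l) (hF1 : ∀ l, 0 < l → f l ≤ 0 → 1 - f l ≤ F l)
    (l : V → ℤ) (hl : 0 ≤ l) :
    -f l ≤ sumComp M F l ∧ (l ≠ 0 → f l ≤ 0 → 1 - f l ≤ sumComp M F l) := by
  refine component_induction (M := M) (P := fun l => -f l ≤ sumComp M F l ∧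
    (l ≠ 0 → f l ≤ 0 → 1 - f l ≤ sumComp M F l)) ?_ ?_ l hl
  · simp [hf0, sumComp_zero]
  · intro W hW c ⟨ih, ih1⟩
    have hsum := sumComp_eq_add_sub F c
    have hfW := hadd _ _ (separated_compCycle c)
    rw [add_sub_cancel] at hfW
    have hpos : 0 < compCycle M W c := lt_of_le_of_ne (compCycle_nonneg hW c) (compCycle_ne c).symm
    have hFc := hF _ hpos
    refine ⟨by linarith, fun _ hle => ?_⟩
    by_cases hc : f (compCycle M W c) ≤ 0
    · linarith [hF1 _ hpos hc]
    · have hne : W - compCycle M W c ≠ 0 := by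
        intro h0
        rw [h0, hf0] at hfW
        linarith
      linarith [ih1 hne (by linarith)]

/-- Lemma 6.6(a).  For every connected component `Z'_i` of a
`≤`-minimal maximizer `Z'`, the minimum `min_{0≤l≤Z'_i} χ(−l'+l)` is realized
by `l = Z'_i`. -/
theorem stmt_5
    (V : Type) [Fintype V] [DecidableEq V] [Nonempty V]
    (M : Matrix V V ℤ)
    (hsym : ∀ u v, M u v = M v u)
    (hneg : ∀ x : V → ℚ, x ≠ 0 → pairQ M x x < 0)
    (hoff : ∀ u v : V, u ≠ v → 0 ≤ M u v)
    (hconn : (dualGraph M).Connected)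
    (ZK : V → ℚ)
    (hZK : ∀ v, pairQ M ZK (Pi.single v 1) = (M v v : ℚ) + 2)
    (l' : V → ℚ)
    (hl' : ∀ v, ∃ n : ℕ, pairQ M l' (Pi.single v 1) = n)
    (Z : V → ℤ) (hZ : ∀ v, 1 ≤ Z v)
    (hnotdom : ∃ l : V → ℤ, 0 < l ∧ l ≤ Z ∧
      chiQ M ZK (-l' + toQ l) ≤ chiQ M ZK (-l'))
    -- `D` : the dominance defect
    (D : (V → ℤ) → ℚ)
    (hD0 : ∀ W : V → ℤ,
      (∀ l : V → ℤ, 0 < l → l ≤ W → chiQ M ZK (-l') < chiQ M ZK (-l' + toQ l)) →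
      D W = 0)
    (hD1 : ∀ W : V → ℤ,
      (∃ l : V → ℤ, 0 < l ∧ l ≤ W ∧ chiQ M ZK (-l' + toQ l) ≤ chiQ M ZK (-l')) →
      D W = 1)
    -- `μ W = min_{0 ≤ l ≤ W} χ(−l' + l)`
    (μ : (V → ℤ) → ℚ)
    (hμ : ∀ W : V → ℤ, 0 ≤ W →
      IsLeast {q : ℚ | ∃ l : V → ℤ, 0 ≤ l ∧ l ≤ W ∧
        q = chiQ M ZK (-l' + toQ l)} (μ W))
    -- `t = t(Z,l') = max_{0<Z''≤Z} Σ_i T(Z''_i,l')`, `T(W,l') = χ(−l') − μ W + D W`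
    (t : ℚ)
    (ht : IsGreatest {q : ℚ | ∃ W : V → ℤ, 0 < W ∧ W ≤ Z ∧
      q = sumComp M (fun W' => chiQ M ZK (-l') - μ W' + D W') W} t)
    -- `Z'` is a `≤`-minimal realizing cycle
    (Z' : V → ℤ) (hZ'pos : 0 < Z') (hZ'le : Z' ≤ Z)
    (hZ'max : sumComp M (fun W' => chiQ M ZK (-l') - μ W' + D W') Z' = t)
    (hZ'min : ∀ W : V → ℤ, 0 < W → W ≤ Z →
      sumComp M (fun W' => chiQ M ZK (-l') - μ W' + D W') W = t → W ≤ Z' → W = Z') :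
    ∀ c : (inducedOnSupp M Z').ConnectedComponent,
      IsLeast {q : ℚ | ∃ l : V → ℤ, 0 ≤ l ∧ l ≤ compCycle M Z' c ∧
          q = chiQ M ZK (-l' + toQ l)}
        (chiQ M ZK (-l' + toQ (compCycle M Z' c))) := by
  intro c
  set F : (V → ℤ) → ℚ := fun W' => chiQ M ZK (-l') - μ W' + D W' with hFdef
  set f : (V → ℤ) → ℚ := fun l => chiQ M ZK (-l' + toQ l) - chiQ M ZK (-l') with hfdef
  have hf0 : f 0 = 0 := by simp [hfdef, toQ_zero]
  have hadd : ∀ A B, Separated M A B → f (A + B) = f A + f B := by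
    intro A B h
    have := h.chiQ_add hsym hoff ZK (-l')
    simp only [hfdef]
    linarith
  have hD : ∀ W, 0 ≤ D W := by
    intro W
    by_cases h : ∃ l : V → ℤ, 0 < l ∧ l ≤ W ∧ chiQ M ZK (-l' + toQ l) ≤ chiQ M ZK (-l')
    · rw [hD1 W h]
      exact zero_le_one
    · push Not at h
      exact (hD0 W h).ge
  have hμle : ∀ W l : V → ℤ, 0 ≤ l → l ≤ W → μ W ≤ f l + chiQ M ZK (-l') := by
    intro W l h0 hl
    have := (hμ W (h0.trans hl)).2 ⟨l, h0, hl, rfl⟩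
    simp only [hfdef]
    linarith
  have hF : ∀ l, 0 < l → -f l ≤ F l := by
    intro l hl
    have := hμle l l hl.le le_rfl
    have := hD l
    simp only [hFdef]
    linarith
  have hF1 : ∀ l, 0 < l → f l ≤ 0 → 1 - f l ≤ F l := by
    intro l hl hle
    have := hμle l l hl.le le_rfl
    have := hD1 l ⟨l, hl, le_rfl, sub_nonpos.1 hle⟩
    simp only [hFdef]
    linarith
  have hsumge := neg_le_sumComp hf0 hadd hF hF1
  have ht1 : 1 ≤ t := by
    have hZ0 : ∀ v, Z v ≠ 0 := fun v => (zero_lt_one.trans_le (hZ v)).ne'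
    obtain ⟨v₀⟩ := ‹Nonempty V›
    have hZpos : 0 < Z := lt_of_le_of_ne (fun v => zero_le_one.trans (hZ v))
      (fun h => hZ0 v₀ (congrFun h v₀).symm)
    have hle := ht.2 ⟨Z, hZpos, le_rfl, rfl⟩
    rw [sumComp_eq_of_reachIn F hZpos.ne' fun u v _ _ => .of_connected hconn hZ0 u v] at hle
    have := hμle Z 0 le_rfl hZpos.le
    have := hD1 Z hnotdom
    simp only [hFdef] at hle
    linarith
  have hC0 := compCycle_nonneg hZ'pos.le c
  have hCle := compCycle_le hZ'pos.le c
  refine ⟨⟨_, hC0, le_rfl, rfl⟩, ?_⟩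
  obtain ⟨l, hl0, hlC, hlμ, hlF⟩ : ∃ l : V → ℤ, 0 ≤ l ∧ l ≤ compCycle M Z' c ∧
      μ (compCycle M Z' c) = chiQ M ZK (-l' + toQ l) ∧
      F (compCycle M Z' c) ≤ sumComp M F l := by
    obtain ⟨l, hl0, hlC, hlμ⟩ := (hμ _ hC0).1
    have hfl : f l = μ (compCycle M Z' c) - chiQ M ZK (-l') := by rw [hlμ]
    have hμ0 := hμle _ 0 le_rfl hC0
    by_cases h : ∃ k : V → ℤ, 0 < k ∧ k ≤ compCycle M Z' c ∧
        chiQ M ZK (-l' + toQ k) ≤ chiQ M ZK (-l')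
    · have hDC := hD1 _ h
      by_cases hl : l = 0
      · obtain ⟨k, hk, hkC, hkle⟩ := h
        have hkμ := hμle _ k hk.le hkC
        rw [hl, hf0] at hfl
        have hfk : f k = 0 := le_antisymm (sub_nonpos.2 hkle) (by linarith)
        have := (hsumge k hk.le).2 hk.ne' hfk.le
        refine ⟨k, hk.le, hkC, ?_, ?_⟩
        · simp only [hfdef] at hfk
          linarith
        · simp only [hFdef] at this ⊢
          linarith
      · have := (hsumge l hl0).2 hl (by linarith)
        refine ⟨l, hl0, hlC, hlμ, ?_⟩
        simp only [hFdef] at this ⊢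
        linarith
    · push Not at h
      have hDC := hD0 _ h
      have := (hsumge l hl0).1
      refine ⟨l, hl0, hlC, hlμ, ?_⟩
      simp only [hFdef] at this ⊢
      linarith
  have hsep : Separated M (Z' - compCycle M Z' c) l :=
    (separated_compCycle c).symm.mono_right fun v hv h0 =>
      hv (le_antisymm (h0 ▸ hlC v) (hl0 v))
  have hsum : t ≤ sumComp M F (Z' - compCycle M Z' c + l) := by
    rw [hsep.sumComp_add, ← hZ'max, sumComp_eq_add_sub F c]
    linarith
  have hWle : Z' - compCycle M Z' c + l ≤ Z' := by
    intro v
    have := hlC v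
    simp only [Pi.add_apply, Pi.sub_apply]
    linarith
  have hWpos : 0 < Z' - compCycle M Z' c + l := by
    refine lt_of_le_of_ne (add_nonneg (sub_nonneg.2 hCle) hl0) fun h0 => ?_
    rw [← h0, sumComp_zero] at hsum
    linarith
  have hWZ := hWle.trans hZ'le
  have hWeq := hZ'min _ hWpos hWZ (le_antisymm (ht.2 ⟨_, hWpos, hWZ, rfl⟩) hsum) hWle
  have hleq : l = compCycle M Z' c := by
    funext v
    have := congrFun hWeq v
    simp only [Pi.add_apply, Pi.sub_apply] at this
    linarith
  rw [congrArg toQ hleq.symm, ← hlμ]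
  exact (hμ _ hC0).2
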